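/- Let ρ and α be smooth, positive, l-periodic probability densities on 𝒳 = [-l/2, l/2]^d, and let V be a smooth l-periodic function on ℝ^d. Then: (i) ∫_𝒳 [Δρ · log(ρ/α) - (ρ/α)·Δα] dx = -∫_𝒳 ‖∇log ρ - ∇log α‖² ρ dx; and (ii) ∫_𝒳 [div(ρ∇V)·log(ρ/α) - (ρ/α)·div(α∇V)] dx = 0, where the boundary terms in integration by parts vanish by periodicity. -/

import Mathlib

open MeasureTheory Set

noncomputable section

abbrev E (d : ℕ) := EuclideanSpace ℝ (Fin d)

def uvec (d : ℕ) (i : Fin d) : E d := EuclideanSpace.single i (1 : ℝ)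

def box (d : ℕ) (l : ℝ) : Set (E d) := {x | ∀ i, x i ∈ Icc (-(l / 2)) (l / 2)}

def IsPeriodic {d : ℕ} {β : Type*} (l : ℝ) (g : E d → β) : Prop :=
  ∀ (x : E d) (i : Fin d), g (x + l • uvec d i) = g x

/-- Divergence of a vector field on `ℝ^d`. -/
def diverg {d : ℕ} (F : E d → E d) (x : E d) : ℝ :=
  ∑ i, fderiv ℝ F x (uvec d i) i

/-- Laplacian of a scalar function on `ℝ^d`. -/
def lap {d : ℕ} (φ : E d → ℝ) (x : E d) : ℝ :=
  diverg (fun y => gradient φ y) x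

section Periodic

variable {d : ℕ} {l : ℝ}

theorem box_eq_preimage (d : ℕ) (l : ℝ) :
    box d l = WithLp.ofLp ⁻¹' Icc (fun _ : Fin d => -(l / 2)) (fun _ => l / 2) := by
  ext x
  simp [box, Pi.le_def, forall_and]

theorem isCompact_box (d : ℕ) (l : ℝ) : IsCompact (box d l) := by
  rw [box_eq_preimage]
  exact (EuclideanSpace.equiv (Fin d) ℝ).toHomeomorph.isCompact_preimage.2 isCompact_Icc

theorem continuous_diverg {F : E d → E d} (hF : ContDiff ℝ 1 F) : Continuous (diverg F) := by
  have h := hF.continuous_fderiv one_ne_zero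
  unfold diverg
  fun_prop

theorem IsPeriodic.gradient {f : E d → ℝ} (hf : IsPeriodic l f) :
    IsPeriodic l (gradient f) := fun x i => by
  have h : (fun y => f (y + l • uvec d i)) = f := funext fun y => hf y i
  simp only [_root_.gradient]
  rw [← fderiv_comp_add_right, h]

theorem ContDiff.gradient {f : E d → ℝ} (hf : ContDiff ℝ (⊤ : ℕ∞) f) :
    ContDiff ℝ 1 (gradient f) :=
  (InnerProductSpace.toDual ℝ (E d)).symm.contDiff.comp
    (hf.fderiv_right (m := 1) (WithTop.coe_le_coe.2 (le_top : (1 + 1 : ℕ∞) ≤ ⊤)))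

/-- The divergence theorem on the torus: the opposite faces of the box cancel. -/
theorem integral_diverg_eq_zero (hl : 0 < l) {F : E d → E d} (hF : ContDiff ℝ 1 F)
    (hper : IsPeriodic l F) : ∫ x in box d l, diverg F x = 0 := by
  cases d with
  | zero => simp [diverg]
  | succ n =>
    let e := EuclideanSpace.equiv (Fin (n + 1)) ℝ
    have hdiff : Differentiable ℝ F := hF.differentiable one_ne_zero
    have hvol : MeasurePreserving e.symm volume volume :=
      PiLp.volume_preserving_toLp (Fin (n + 1))
    have hbox : e.symm ⁻¹' box (n + 1) l =
        Icc (fun _ => -(l / 2)) (fun _ => l / 2) := by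
      rw [box_eq_preimage]; rfl
    rw [← hvol.setIntegral_preimage_emb e.symm.toHomeomorph.measurableEmbedding, hbox]
    have hdiv : ∀ y, diverg F (e.symm y) = ∑ i : Fin (n + 1),
        ((EuclideanSpace.proj i : E (n + 1) →L[ℝ] ℝ) ∘L fderiv ℝ F (e.symm y) ∘L
          (e.symm : (Fin (n + 1) → ℝ) →L[ℝ] E (n + 1))) (Pi.single i 1) := fun y => rfl
    have hcont : Continuous fun y => diverg F (e.symm y) :=
      (continuous_diverg hF).comp e.symm.continuous
    simp only [hdiv] at hcont ⊢
    rw [integral_divergence_of_hasFDerivAt_off_countable' _ _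
      (fun _ => by dsimp only; linarith) (fun i y => F (e.symm y) i) _ ∅ countable_empty
      (fun i => ?_) (fun y _ i => ?_) (hcont.continuousOn.integrableOn_compact isCompact_Icc)]
    · refine Finset.sum_eq_zero fun i _ => sub_eq_zero.2 (integral_congr_ae (.of_forall fun y => ?_))
      have hface : e.symm (i.insertNth (l / 2) y) =
          e.symm (i.insertNth (-(l / 2)) y) + l • uvec (n + 1) i := by
        ext j
        refine i.succAboveCases ?_ (fun k => ?_) j
        · simp [e, uvec]; ring
        · simp [e, uvec]
      simp only [hface, hper _ i]
    · exact Continuous.continuousOn <| (EuclideanSpace.proj i : E (n + 1) →L[ℝ] ℝ).continuous.comp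
        (hF.continuous.comp e.symm.continuous)
    · exact (EuclideanSpace.proj i : E (n + 1) →L[ℝ] ℝ).hasFDerivAt.comp y
        ((hdiff (e.symm y)).hasFDerivAt.comp y e.symm.hasFDerivAt)

theorem diverg_smul {φ : E d → ℝ} {F : E d → E d} {x : E d}
    (hφ : DifferentiableAt ℝ φ x) (hF : DifferentiableAt ℝ F x) :
    diverg (fun y => φ y • F y) x = φ x * diverg F x + inner ℝ (gradient φ x) (F x) := by
  have hx : F x = ∑ i, F x i • uvec d i := by
    ext j; simp [uvec, Finset.sum_apply, Pi.single_apply]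
  have h : inner ℝ (gradient φ x) (F x) = ∑ i, fderiv ℝ φ x (uvec d i) * F x i := by
    rw [inner_gradient_left]
    conv_lhs => rw [hx]
    simp [mul_comm]
  rw [h, diverg, fderiv_fun_smul hφ hF, diverg, Finset.mul_sum, ← Finset.sum_add_distrib]
  simp

theorem diverg_sub {F G : E d → E d} {x : E d}
    (hF : DifferentiableAt ℝ F x) (hG : DifferentiableAt ℝ G x) :
    diverg (fun y => F y - G y) x = diverg F x - diverg G x := by
  simp [diverg, fderiv_fun_sub hF hG]

theorem gradient_log {f : E d → ℝ} {x : E d} (hf : DifferentiableAt ℝ f x) (hx : f x ≠ 0) :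
    gradient (fun y => Real.log (f y)) x = (f x)⁻¹ • gradient f x := by
  simp [gradient, fderiv.log hf hx]

theorem gradient_log_div {f g : E d → ℝ} {x : E d} (hf : Differentiable ℝ f)
    (hg : Differentiable ℝ g) (hfpos : ∀ y, 0 < f y) (hgpos : ∀ y, 0 < g y) :
    gradient (fun y => Real.log (f y / g y)) x =
      gradient (fun y => Real.log (f y)) x - gradient (fun y => Real.log (g y)) x := by
  have h : (fun y => Real.log (f y / g y)) = fun y => Real.log (f y) - Real.log (g y) :=
    funext fun y => Real.log_div (hfpos y).ne' (hgpos y).ne'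
  rw [h]
  simp only [gradient]
  rw [fderiv_fun_sub ((hf x).log (hfpos x).ne') ((hg x).log (hgpos x).ne'), map_sub]

/-- Testing `div F` against `log (ρ / α)` and `div G` against `ρ / α` on the torus moves the
derivatives onto the relative density, whose logarithmic gradient is `∇ log ρ - ∇ log α`. -/
theorem integral_diverg_mul_log_div_sub (hl : 0 < l) {ρ α : E d → ℝ}
    (hρ : ContDiff ℝ 1 ρ) (hα : ContDiff ℝ 1 α)
    (hρpos : ∀ x, 0 < ρ x) (hαpos : ∀ x, 0 < α x)
    (hρper : IsPeriodic l ρ) (hαper : IsPeriodic l α) {F G : E d → E d}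
    (hF : ContDiff ℝ 1 F) (hG : ContDiff ℝ 1 G) (hFper : IsPeriodic l F) (hGper : IsPeriodic l G) :
    ∫ x in box d l, (diverg F x * Real.log (ρ x / α x) - (ρ x / α x) * diverg G x) =
      -∫ x in box d l, inner ℝ
        (gradient (fun y => Real.log (ρ y)) x - gradient (fun y => Real.log (α y)) x)
        (F x - (ρ x / α x) • G x) := by
  have hq : ContDiff ℝ 1 fun x => ρ x / α x := hρ.div hα fun x => (hαpos x).ne'
  have hqpos : ∀ x, 0 < ρ x / α x := fun x => div_pos (hρpos x) (hαpos x)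
  have hlog : ContDiff ℝ 1 fun x => Real.log (ρ x / α x) := hq.log fun x => (hqpos x).ne'
  have hH : ContDiff ℝ 1 fun x => Real.log (ρ x / α x) • F x - (ρ x / α x) • G x :=
    (hlog.smul hF).sub (hq.smul hG)
  have hHper : IsPeriodic l fun x => Real.log (ρ x / α x) • F x - (ρ x / α x) • G x :=
    fun x i => by simp only [hρper x i, hαper x i, hFper x i, hGper x i]
  have hdiv : ∀ x, diverg (fun x => Real.log (ρ x / α x) • F x - (ρ x / α x) • G x) x =
      (diverg F x * Real.log (ρ x / α x) - (ρ x / α x) * diverg G x) + inner ℝ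
        (gradient (fun y => Real.log (ρ y)) x - gradient (fun y => Real.log (α y)) x)
        (F x - (ρ x / α x) • G x) := fun x => by
    have dq := hq.differentiable one_ne_zero x
    have dlog := hlog.differentiable one_ne_zero x
    have dF := hF.differentiable one_ne_zero x
    have dG := hG.differentiable one_ne_zero x
    have hgrad : gradient (fun x => ρ x / α x) x =
        (ρ x / α x) • gradient (fun x => Real.log (ρ x / α x)) x := by
      rw [gradient_log dq (hqpos x).ne', smul_inv_smul₀ (hqpos x).ne']
    rw [diverg_sub (dlog.fun_smul dF) (dq.fun_smul dG), diverg_smul dlog dF, diverg_smul dq dG,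
      hgrad, ← gradient_log_div (hρ.differentiable one_ne_zero) (hα.differentiable one_ne_zero)
        hρpos hαpos, inner_sub_right, inner_smul_left, inner_smul_right]
    simp only [conj_trivial]
    ring
  have hcont : Continuous fun x =>
      diverg F x * Real.log (ρ x / α x) - (ρ x / α x) * diverg G x :=
    ((continuous_diverg hF).mul hlog.continuous).sub (hq.continuous.mul (continuous_diverg hG))
  have hcont' : Continuous fun x => inner ℝ
      (gradient (fun y => Real.log (ρ y)) x - gradient (fun y => Real.log (α y)) x)
      (F x - (ρ x / α x) • G x) :=
    ((continuous_diverg hH).sub hcont).congr fun x => sub_eq_of_eq_add' (hdiv x)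
  have hzero := integral_diverg_eq_zero hl hH hHper
  simp only [hdiv] at hzero
  rw [integral_add (hcont.continuousOn.integrableOn_compact (isCompact_box d l))
    (hcont'.continuousOn.integrableOn_compact (isCompact_box d l))] at hzero
  exact eq_neg_of_add_eq_zero_left hzero

end Periodic

/-- integration-by-parts identities on the torus: for smooth positive
`l`-periodic probability densities `ρ, α` on `𝒳 = [-l/2,l/2]^d` and a smooth
`l`-periodic potential `V`,
(i) `∫_𝒳 [Δρ log(ρ/α) - (ρ/α) Δα] = -∫_𝒳 ‖∇log ρ - ∇log α‖² ρ`, and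
(ii) `∫_𝒳 [div(ρ∇V) log(ρ/α) - (ρ/α) div(α∇V)] = 0`. -/
theorem integration_by_parts_identities_periodic
    (d : ℕ) (l : ℝ) (hl : 0 < l)
    (ρ α : E d → ℝ)
    (hρsmooth : ContDiff ℝ (⊤ : ℕ∞) ρ) (hαsmooth : ContDiff ℝ (⊤ : ℕ∞) α)
    (hρpos : ∀ x, 0 < ρ x) (hαpos : ∀ x, 0 < α x)
    (hρper : IsPeriodic l ρ) (hαper : IsPeriodic l α)
    (hρprob : ∫ x in box d l, ρ x = 1) (hαprob : ∫ x in box d l, α x = 1)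
    (V : E d → ℝ) (hVsmooth : ContDiff ℝ (⊤ : ℕ∞) V) (hVper : IsPeriodic l V) :
    (∫ x in box d l,
        (lap ρ x * Real.log (ρ x / α x) - (ρ x / α x) * lap α x)) =
      -∫ x in box d l,
        ‖gradient (fun y => Real.log (ρ y)) x - gradient (fun y => Real.log (α y)) x‖ ^ 2
          * ρ x ∧
    (∫ x in box d l,
        (diverg (fun y => ρ y • gradient V y) x * Real.log (ρ x / α x)
          - (ρ x / α x) * diverg (fun y => α y • gradient V y) x)) = 0 := by
  have hρ : ContDiff ℝ 1 ρ := hρsmooth.of_le (by exact_mod_cast le_top)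
  have hα : ContDiff ℝ 1 α := hαsmooth.of_le (by exact_mod_cast le_top)
  constructor
  · refine (integral_diverg_mul_log_div_sub hl hρ hα hρpos hαpos hρper hαper hρsmooth.gradient
      hαsmooth.gradient hρper.gradient hαper.gradient).trans ?_
    congr 2 with x
    have hfield : gradient ρ x - (ρ x / α x) • gradient α x = ρ x •
        (gradient (fun y => Real.log (ρ y)) x - gradient (fun y => Real.log (α y)) x) := by
      rw [gradient_log (hρ.differentiable one_ne_zero x) (hρpos x).ne',
        gradient_log (hα.differentiable one_ne_zero x) (hαpos x).ne', smul_sub,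
        smul_inv_smul₀ (hρpos x).ne', smul_smul, div_eq_mul_inv]
    rw [hfield, inner_smul_right, real_inner_self_eq_norm_sq, mul_comm]
  · refine (integral_diverg_mul_log_div_sub hl hρ hα hρpos hαpos hρper hαper
      (F := fun y => ρ y • gradient V y) (G := fun y => α y • gradient V y)
      (hρ.smul hVsmooth.gradient) (hα.smul hVsmooth.gradient)
      (fun x i => by simp only [hρper x i, hVper.gradient x i])
      (fun x i => by simp only [hαper x i, hVper.gradient x i])).trans ?_
    simp [smul_smul, (hαpos _).ne']
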